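/- Suppose M = N. Then the polynomial P has exactly M roots in ℂ, all of them real and simple; listed in increasing order as μ₁ < μ₂ < ⋯ < μ_M they satisfy μ₁ = 0 and the strict interlacing 0 = μ₁ < λ₁ < μ₂ < λ₂ < ⋯ < λ_{M−1} < μ_M < λ_M. -/

import Mathlib

open Finset

/-- A continuous real function with values of opposite signs at the endpoints of an interval
vanishes in its interior. -/
lemma exists_zero_of_mul_neg {f : ℝ → ℝ} (hf : Continuous f) {a b : ℝ} (hab : a < b)
    (h : f a * f b < 0) : ∃ x, a < x ∧ x < b ∧ f x = 0 := by
  rcases mul_neg_iff.mp h with ⟨ha, hb⟩ | ⟨ha, hb⟩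
  · obtain ⟨x, hx, hx0⟩ := intermediate_value_Ioo' hab.le hf.continuousOn ⟨hb, ha⟩
    exact ⟨x, hx.1, hx.2, hx0⟩
  · obtain ⟨x, hx, hx0⟩ := intermediate_value_Ioo hab.le hf.continuousOn ⟨ha, hb⟩
    exact ⟨x, hx.1, hx.2, hx0⟩

/-- The products of differences to two consecutive nodes have opposite signs. -/
lemma prod_erase_sub_mul_prod_erase_sub_neg {M : ℕ} {l : Fin M → ℝ} (hl : StrictMono l)
    {i j : Fin M} (hij : (i : ℕ) + 1 = j) :
    (∏ k ∈ univ.erase i, (l k - l i)) * ∏ k ∈ univ.erase j, (l k - l j) < 0 := by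
  have hlt : i < j := by rw [Fin.lt_def]; omega
  have hl' := hl hlt
  rw [← mul_prod_erase (univ.erase i) (fun k => l k - l i) (a := j) (by simp [hlt.ne']),
    ← mul_prod_erase (univ.erase j) (fun k => l k - l j) (a := i) (by simp [hlt.ne]),
    erase_right_comm (a := j), mul_mul_mul_comm, ← prod_mul_distrib]
  refine mul_neg_of_neg_of_pos (mul_neg_of_pos_of_neg (by linarith) (by linarith)) ?_
  refine prod_pos fun k hk => ?_
  simp only [mem_erase, mem_univ, and_true] at hk
  rcases lt_or_gt_of_ne hk.2 with h | h
  · exact mul_pos_of_neg_of_neg (by linarith [hl h]) (by linarith [hl h])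
  · have hjk : j < k := lt_of_le_of_ne (by rw [Fin.le_def]; rw [Fin.lt_def] at h; omega)
      (Ne.symm hk.1)
    exact mul_pos (by linarith [hl h]) (by linarith [hl hjk])

open Polynomial in
lemma degree_prod_C_sub_X {ι : Type*} (s : Finset ι) (a : ι → ℂ) :
    (∏ k ∈ s, (C (a k) - X)).degree = (s.card : WithBot ℕ) := by
  have h : ∀ k, (C (a k) - X : ℂ[X]).degree = 1 := fun k => by
    rw [← neg_sub, degree_neg, degree_X_sub_C]
  simp [degree_prod, h]

open Polynomial in
lemma leadingCoeff_prod_C_sub_X {ι : Type*} (s : Finset ι) (a : ι → ℂ) :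
    (∏ k ∈ s, (C (a k) - X)).leadingCoeff = (-1) ^ s.card := by
  have h : ∀ k, (C (a k) - X : ℂ[X]).leadingCoeff = -1 := fun k => by
    rw [← neg_sub, leadingCoeff_neg, leadingCoeff_X_sub_C]
  simp [leadingCoeff_prod, h]

open Polynomial in
/-- A polynomial with leading part `∏ₖ (aₖ - z)`, perturbed by lower-order products, is determined
by `M` distinct roots. -/
lemma prod_sub_sum_eq_prod_of_roots {M : ℕ} (hM : 0 < M) (a b w : Fin M → ℂ) (c : ℂ)
    (hb : Function.Injective b)
    (hroot : ∀ j, (∏ k, (a k - b j)) - c * ∑ r, w r * ∏ k ∈ univ.erase r, (a k - b j) = 0)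
    (z : ℂ) :
    (∏ k, (a k - z)) - c * ∑ r, w r * ∏ k ∈ univ.erase r, (a k - z) = ∏ k, (b k - z) := by
  set A : ℂ[X] := ∏ k, (C (a k) - X)
  set B : ℂ[X] := ∏ k, (C (b k) - X)
  set S : ℂ[X] := C c * ∑ r, C (w r) * ∏ k ∈ univ.erase r, (C (a k) - X)
  have hA : A.degree = M := by simpa using degree_prod_C_sub_X univ a
  have hB : B.degree = M := by simpa using degree_prod_C_sub_X univ b
  have hAB : (A - B).degree < M := by
    rw [← hA]
    refine degree_sub_lt_left (hA.trans hB.symm) ?_ ?_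
    · intro h
      simp [h] at hA
    · rw [leadingCoeff_prod_C_sub_X, leadingCoeff_prod_C_sub_X]
  have hS : S.degree < M := by
    simp only [S]
    rw [← mem_degreeLT, ← smul_eq_C_mul]
    refine Submodule.smul_mem _ _ (Submodule.sum_mem _ fun r _ => ?_)
    rw [← smul_eq_C_mul]
    refine Submodule.smul_mem _ _ ?_
    rw [mem_degreeLT, degree_prod_C_sub_X, card_erase_of_mem (mem_univ r), card_univ,
      Fintype.card_fin]
    exact_mod_cast Nat.sub_lt hM one_pos
  have key : A - S = B := by
    refine eq_of_degree_sub_lt_of_eval_index_eq univ hb.injOn ?_ fun j _ => ?_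
    · rw [card_univ, Fintype.card_fin, sub_right_comm]
      exact (degree_sub_le _ _).trans_lt (max_lt hAB hS)
    · have hBj : B.eval (b j) = 0 := by
        rw [eval_prod]
        exact prod_eq_zero (mem_univ j) (by simp)
      rw [hBj, ← hroot j]
      simp [A, S, eval_prod, eval_finsetSum]
  simpa [A, B, S, eval_prod, eval_finsetSum] using congrArg (eval z) key

/-- Suppose `M = N`. Then the polynomial
`P(z) = ∏ₖ (λₖ − z) − (1/N) Σᵣ λᵣ ∏_{k≠r} (λₖ − z)` has exactly `M` roots in `ℂ`, all of
them real and simple; listed in increasing order as `μ₁ < ⋯ < μ_M` they satisfy `μ₁ = 0`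
and the strict interlacing `0 = μ₁ < λ₁ < μ₂ < λ₂ < ⋯ < λ_{M−1} < μ_M < λ_M`. -/
theorem stmt1 (M N : ℕ) (hM : 0 < M) (hN : 0 < N) (hMN : M = N)
    (l : Fin M → ℝ) (hmono : StrictMono l) (hpos : ∀ k, 0 < l k) :
    ∃ μ : Fin M → ℝ,
      StrictMono μ ∧
      (∀ z : ℂ,
        (∏ k, ((l k : ℂ) - z)) -
            (1 / (N : ℂ)) * ∑ r, (l r : ℂ) * ∏ k ∈ Finset.univ.erase r, ((l k : ℂ) - z)
          = ∏ k, ((μ k : ℂ) - z)) ∧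
      μ ⟨0, hM⟩ = 0 ∧
      (∀ k : Fin M, μ k < l k) ∧
      (∀ k : Fin M, ∀ h : (k : ℕ) + 1 < M, l k < μ ⟨(k : ℕ) + 1, h⟩) := by
  subst hMN
  have hM' : (0 : ℝ) < M := by exact_mod_cast hM
  set P : ℝ → ℝ := fun x =>
    (∏ k, (l k - x)) - (1 / (M : ℝ)) * ∑ r, l r * ∏ k ∈ univ.erase r, (l k - x) with hP
  have hcont : Continuous P := by
    rw [hP]
    fun_prop
  have hnode : ∀ i, P (l i) = -(1 / (M : ℝ) * l i) * ∏ k ∈ univ.erase i, (l k - l i) := by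
    intro i
    have h0 : ∏ k, (l k - l i) = 0 := prod_eq_zero (mem_univ i) (sub_self _)
    have h1 : ∑ r, l r * ∏ k ∈ univ.erase r, (l k - l i)
        = l i * ∏ k ∈ univ.erase i, (l k - l i) := by
      refine sum_eq_single i (fun r _ hr => ?_) (by simp)
      rw [prod_eq_zero (i := i) (by simp [hr.symm]) (sub_self _), mul_zero]
    simp only [hP, h0, h1]
    ring
  have hzero : P 0 = 0 := by
    have h1 : ∀ r, l r * ∏ k ∈ univ.erase r, l k = ∏ k, l k := fun r =>
      mul_prod_erase univ l (mem_univ r)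
    simp [hP, h1, hM'.ne']
  have hex : ∀ k : Fin M, ∃ x, P x = 0 ∧ x < l k ∧ ((k : ℕ) = 0 → x = 0) ∧
      ∀ j : Fin M, (j : ℕ) + 1 = k → l j < x := by
    intro k
    by_cases hk : (k : ℕ) = 0
    · exact ⟨0, hzero, hpos k, fun _ => rfl, fun j hj => by omega⟩
    · obtain ⟨i, hi⟩ : ∃ i : Fin M, (i : ℕ) + 1 = k := ⟨⟨k - 1, by omega⟩, by simp; omega⟩
      have hik : i < k := by rw [Fin.lt_def]; omega
      obtain ⟨x, h1, h2, h3⟩ := exists_zero_of_mul_neg hcont (hmono hik) (by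
        rw [hnode, hnode, mul_mul_mul_comm, neg_mul_neg]
        have := hpos i
        have := hpos k
        exact mul_neg_of_pos_of_neg (by positivity)
          (prod_erase_sub_mul_prod_erase_sub_neg hmono hi))
      refine ⟨x, h3, h2, fun h => absurd h hk, fun j hj => ?_⟩
      rwa [show j = i from Fin.ext (by omega)]
  choose μ hroot hlt h0 hgt using hex
  have hμ : StrictMono μ := by
    intro i j hij
    rw [Fin.lt_def] at hij
    have hle : l i ≤ l ⟨j - 1, by omega⟩ := hmono.monotone (by rw [Fin.le_def]; simp; omega)
    exact (hlt i).trans_le (hle.trans (hgt j ⟨j - 1, by omega⟩ (by simp; omega)).le)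
  refine ⟨μ, hμ, ?_, h0 _ rfl, hlt, fun k h => hgt _ k rfl⟩
  refine prod_sub_sum_eq_prod_of_roots hM (fun k => (l k : ℂ)) (fun k => (μ k : ℂ))
    (fun k => (l k : ℂ)) _ (Complex.ofReal_injective.comp hμ.injective) fun j => ?_
  have h := congrArg Complex.ofReal (hroot j)
  simp only [hP] at h
  push_cast at h
  exact h
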